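/- Let 0 ≤ α ≤ β and let f : ℝ → ℝ be of bounded variation. Then V(M^β f) ≤ V(M^α f). Consequently, defining B(γ) = sup{ V(M^γ f)/V(f) : f of bounded variation, V(f) > 0 }, one has B(γ) = 1 for every γ ≥ 1/3. -/

import Mathlib

open MeasureTheory Set Filter Topology NNReal ENNReal

/-- The average of `|f|` over the interval `[y - t, y + t]`. -/
noncomputable def avgAbs (f : ℝ → ℝ) (y t : ℝ) : ℝ :=
  (1 / (2 * t)) * ∫ s in (y - t)..(y + t), |f s|

/-- The nontangential Hardy–Littlewood maximal function. -/
noncomputable def ntMax (α : ℝ) (f : ℝ → ℝ) (x : ℝ) : ℝ :=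
  sSup {r : ℝ | ∃ y t : ℝ, 0 < t ∧ |x - y| ≤ α * t ∧ r = avgAbs f y t}

/-- `B(γ) = sup { V(M^γ f) / V(f) : f of bounded variation with V(f) > 0 }`. -/
noncomputable def Bconst (γ : ℝ) : ℝ≥0∞ :=
  ⨆ (f : ℝ → ℝ) (_ : BoundedVariationOn f Set.univ ∧ eVariationOn f Set.univ ≠ 0),
    eVariationOn (ntMax γ f) Set.univ / eVariationOn f Set.univ

/-- The variation of `G` along a finite sequence is also its variation along a sequence on which
consecutive values of `G` are distinct. -/
lemma exists_monotone_consecutive_ne (G : ℝ → ℝ) (u : ℕ → ℝ) (hu : Monotone u) (n : ℕ) :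
    ∃ (m : ℕ) (v : ℕ → ℝ), Monotone v ∧ (∀ i < m, G (v (i + 1)) ≠ G (v i)) ∧
      v m ≤ u n ∧ G (v m) = G (u n) ∧
      ∑ i ∈ Finset.range n, |G (u (i + 1)) - G (u i)| =
        ∑ i ∈ Finset.range m, |G (v (i + 1)) - G (v i)| := by
  induction n with
  | zero => exact ⟨0, u, hu, by simp, le_rfl, rfl, by simp⟩
  | succ n ih =>
    obtain ⟨m, v, hv, hne, hle, heq, hsum⟩ := ih
    have hun : u n ≤ u (n + 1) := hu n.le_succ
    by_cases h : G (u (n + 1)) = G (u n)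
    · refine ⟨m, v, hv, hne, hle.trans hun, heq.trans h.symm, ?_⟩
      rw [Finset.sum_range_succ, hsum, h]
      simp
    · refine ⟨m + 1, fun i => if i ≤ m then v i else u (n + 1), ?_, ?_, ?_, ?_, ?_⟩
      · intro i j hij
        have := hv hij
        by_cases hi : i ≤ m
        · have := hv hi
          by_cases hj : j ≤ m <;> simp only [hi, hj, if_true, if_false] <;> linarith
        · have hj : ¬ j ≤ m := by omega
          simp [hi, hj]
      · intro i hi
        rcases (Nat.lt_succ_iff.mp hi).lt_or_eq with h' | rfl
        · have h1 : i + 1 ≤ m := h'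
          simpa [h1, h'.le] using hne i h'
        · simpa [heq] using h
      · simp
      · simp
      · rw [Finset.sum_range_succ, hsum, Finset.sum_range_succ]
        congr 1
        · refine Finset.sum_congr rfl fun i hi => ?_
          have h1 : i + 1 ≤ m := Finset.mem_range.mp hi
          have h2 : i ≤ m := by omega
          simp [h1, h2]
        · simp [heq]

/-- `G` has variation at most that of `F` as soon as `F` comes below the values of `G` near every
point, and comes above the values of `G` at its peaks without crossing the neighbouring valleys. -/
theorem eVariationOn_le_of_peaks {F G : ℝ → ℝ}
    (hvalley : ∀ a η δ : ℝ, 0 < η → 0 < δ → ∃ z, |z - a| < δ ∧ F z ≤ G a + η)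
    (hpeak : ∀ (A B : Option ℝ) (x η : ℝ), 0 < η → (∀ a ∈ A, a < x ∧ G a < G x) →
      (∀ b ∈ B, x < b ∧ G b < G x) →
      ∃ y, (∀ a ∈ A, a < y) ∧ (∀ b ∈ B, y < b) ∧ G x - η ≤ F y) :
    eVariationOn G univ ≤ eVariationOn F univ := by
  classical
  refine iSup_le fun ⟨n₀, u, hu, _⟩ => ?_
  have hsum_edist : ∀ (H : ℝ → ℝ) (s : ℕ → ℝ) (k : ℕ),
      ∑ i ∈ Finset.range k, edist (H (s (i + 1))) (H (s i)) =
        ENNReal.ofReal (∑ i ∈ Finset.range k, |H (s (i + 1)) - H (s i)|) := by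
    intro H s k
    rw [ENNReal.ofReal_sum_of_nonneg fun i _ => abs_nonneg _]
    simp [edist_dist, Real.dist_eq]
  obtain ⟨n, v, hv, hne, -, -, hsum⟩ := exists_monotone_consecutive_ne G u hu n₀
  change ∑ i ∈ Finset.range n₀, edist (G (u (i + 1))) (G (u i)) ≤ _
  rw [hsum_edist, hsum]
  rcases Nat.eq_zero_or_pos n with rfl | hn
  · simp
  obtain ⟨p, rfl⟩ : ∃ p, n = p + 1 := ⟨n - 1, by omega⟩
  have hlt : ∀ i < p + 1, v i < v (i + 1) := fun i hi =>
    (hv i.le_succ).lt_of_ne fun h => hne i hi (by rw [h])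
  refine ENNReal.le_of_forall_pos_le_add fun ε hε _ => ?_
  set η : ℝ := ε / (2 * (p + 2)) with hη
  have hη0 : 0 < η := by positivity
  let pk : ℕ → Prop := fun i => (∀ j, j + 1 = i → G (v j) < G (v i)) ∧
    (i < p + 1 → G (v (i + 1)) < G (v i))
  have hy : ∀ i, ∃ y, pk i → i ≤ p + 1 → (∀ j, j + 1 = i → v j < y) ∧
      (i < p + 1 → y < v (i + 1)) ∧ G (v i) - η ≤ F y := by
    intro i
    by_cases hi : pk i ∧ i ≤ p + 1
    · obtain ⟨y, h1, h2, h3⟩ := hpeak (if i = 0 then none else some (v (i - 1)))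
        (if i < p + 1 then some (v (i + 1)) else none) (v i) η hη0
        (by
          intro a ha
          rcases i with _ | i
          · simp at ha
          · simp only [Nat.succ_ne_zero, if_false, Nat.add_sub_cancel, Option.mem_def,
              Option.some.injEq] at ha
            subst ha
            exact ⟨hlt i (by omega), hi.1.1 i rfl⟩)
        (by
          intro b hb
          split_ifs at hb with h
          · simp only [Option.mem_def, Option.some.injEq] at hb
            subst hb
            exact ⟨hlt i h, hi.1.2 h⟩
          · simp at hb)
      refine ⟨y, fun _ _ => ⟨?_, fun h => h2 _ (by simp [h]), h3⟩⟩
      rintro j rfl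
      exact h1 _ (by simp)
    · exact ⟨0, fun h1 h2 => absurd ⟨h1, h2⟩ hi⟩
  choose y hy using hy
  obtain ⟨δ, hδ0, hδ⟩ : ∃ δ : ℝ, 0 < δ ∧ ∀ i ∈ Finset.range (p + 1), 2 * δ < v (i + 1) - v i ∧
      (pk i → δ < v (i + 1) - y i) ∧ (pk (i + 1) → δ < y (i + 1) - v i) := by
    have key : ∀ c : ℝ, 0 < c → ∀ᶠ δ in 𝓝[>] (0 : ℝ), δ < c := fun c hc =>
      nhdsWithin_le_nhds (Iio_mem_nhds hc)
    have : ∀ᶠ δ in 𝓝[>] (0 : ℝ), ∀ i ∈ Finset.range (p + 1), 2 * δ < v (i + 1) - v i ∧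
        (pk i → δ < v (i + 1) - y i) ∧ (pk (i + 1) → δ < y (i + 1) - v i) := by
      rw [Finset.eventually_all]
      intro i hi
      have hi := Finset.mem_range.mp hi
      refine Filter.Eventually.and ?_ (Filter.Eventually.and ?_ ?_)
      · filter_upwards [key ((v (i + 1) - v i) / 2) (by linarith [hlt i hi])] with δ h
        linarith
      · by_cases h : pk i
        · filter_upwards [key (v (i + 1) - y i) (by linarith [(hy i h hi.le).2.1 hi])] with δ h _
          exact h
        · simp [h]
      · by_cases h : pk (i + 1)
        · filter_upwards [key (y (i + 1) - v i) (by linarith [(hy _ h hi).1 i rfl])] with δ h _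
          exact h
        · simp [h]
    obtain ⟨δ, h1, h2⟩ := (this.and self_mem_nhdsWithin).exists
    exact ⟨δ, h2, h1⟩
  choose z hz using fun i => hvalley (v i) η δ hη0 hδ0
  let w : ℕ → ℝ := fun i => if pk i then y i else z i
  have hw_mono : MonotoneOn w (Iic (p + 1)) := by
    have step : ∀ i < p + 1, w i ≤ w (i + 1) := by
      intro i hi
      obtain ⟨h1, h2, h3⟩ := hδ i (Finset.mem_range.mpr hi)
      have z1 := abs_lt.mp (hz i).1
      have z2 := abs_lt.mp (hz (i + 1)).1
      by_cases p1 : pk i <;> by_cases p2 : pk (i + 1)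
      · exact absurd (p1.2 hi) (p2.1 i rfl).not_gt
      · have := h2 p1
        simp only [w, p1, p2, if_true, if_false]; linarith
      · have := h3 p2
        simp only [w, p1, p2, if_true, if_false]; linarith
      · simp only [w, p1, p2, if_false]; linarith
    intro i _ j hj hij
    induction j, hij using Nat.le_induction with
    | base => exact le_rfl
    | succ j _ ih =>
      have hj' : j + 1 ≤ p + 1 := hj
      exact (ih (show j ≤ p + 1 by omega)).trans (step j (by omega))
  have hw_peak : ∀ i ≤ p + 1, pk i → G (v i) - η ≤ F (w i) := by
    intro i hi h
    simpa [w, h] using (hy i h hi).2.2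
  have hw_valley : ∀ i, ¬ pk i → F (w i) ≤ G (v i) + η := by
    intro i h
    simpa [w, h] using (hz i).2
  have main : ∀ k ≤ p,
      (G (v k) < G (v (k + 1)) → ∑ i ∈ Finset.range (k + 1), |G (v (i + 1)) - G (v i)| ≤
        ∑ i ∈ Finset.range (k + 1), |F (w (i + 1)) - F (w i)| -
          (F (w (k + 1)) - G (v (k + 1))) + 2 * (k + 1) * η) ∧
      (G (v (k + 1)) < G (v k) → ∑ i ∈ Finset.range (k + 1), |G (v (i + 1)) - G (v i)| ≤
        ∑ i ∈ Finset.range (k + 1), |F (w (i + 1)) - F (w i)| +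
          (F (w (k + 1)) - G (v (k + 1))) + 2 * (k + 1) * η) := by
    intro k
    induction k with
    | zero =>
      intro _
      simp only [zero_add, Finset.sum_range_one, Nat.cast_zero, mul_one]
      constructor
      · intro h
        have := hw_valley 0 fun hp => (hp.2 (by omega)).not_gt h
        rw [abs_of_pos (sub_pos.mpr h)]
        linarith [le_abs_self (F (w 1) - F (w 0))]
      · intro h
        have := hw_peak 0 (by omega) ⟨by simp, fun _ => h⟩
        rw [abs_of_neg (sub_neg.mpr h)]
        linarith [neg_le_abs (F (w 1) - F (w 0))]
    | succ k ih =>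
      intro hk
      obtain ⟨ih1, ih2⟩ := ih (by omega)
      rw [Finset.sum_range_succ, Finset.sum_range_succ _ (k + 1)]
      push_cast
      rcases lt_or_gt_of_ne (hne k (by omega)) with hd | hd
      · have ih2 := ih2 hd
        constructor
        · intro h
          have := hw_valley (k + 1) fun hp => (hp.1 k rfl).not_gt hd
          rw [abs_of_pos (sub_pos.mpr h)]
          linarith [le_abs_self (F (w (k + 1 + 1)) - F (w (k + 1)))]
        · intro h
          rw [abs_of_neg (sub_neg.mpr h)]
          linarith [neg_le_abs (F (w (k + 1 + 1)) - F (w (k + 1)))]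
      · have ih1 := ih1 hd
        constructor
        · intro h
          rw [abs_of_pos (sub_pos.mpr h)]
          linarith [le_abs_self (F (w (k + 1 + 1)) - F (w (k + 1)))]
        · intro h
          have := hw_peak (k + 1) (by omega) ⟨by rintro j hj; obtain rfl : j = k := by omega
                                                 exact hd, fun _ => h⟩
          rw [abs_of_neg (sub_neg.mpr h)]
          linarith [neg_le_abs (F (w (k + 1 + 1)) - F (w (k + 1)))]
  have hfinal : ∑ i ∈ Finset.range (p + 1), |G (v (i + 1)) - G (v i)| ≤
      ∑ i ∈ Finset.range (p + 1), |F (w (i + 1)) - F (w i)| + ε := by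
    have hε' : 2 * (p + 2) * η = ε := by rw [hη]; field_simp
    obtain ⟨m1, m2⟩ := main p le_rfl
    rcases lt_or_gt_of_ne (hne p (by omega)) with hd | hd
    · have := hw_valley (p + 1) fun hp => (hp.1 p rfl).not_gt hd
      linarith [m2 hd]
    · have := hw_peak (p + 1) le_rfl
        ⟨by rintro j hj; obtain rfl : j = p := by omega
            exact hd, fun h => absurd h (lt_irrefl _)⟩
      linarith [m1 hd]
  calc ENNReal.ofReal (∑ i ∈ Finset.range (p + 1), |G (v (i + 1)) - G (v i)|)
      ≤ ENNReal.ofReal (∑ i ∈ Finset.range (p + 1), |F (w (i + 1)) - F (w i)| + ε) :=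
        ENNReal.ofReal_le_ofReal hfinal
    _ = ∑ i ∈ Finset.range (p + 1), edist (F (w (i + 1))) (F (w i)) + ε := by
        rw [ENNReal.ofReal_add (Finset.sum_nonneg fun _ _ => abs_nonneg _) ε.coe_nonneg,
          hsum_edist, ENNReal.ofReal_coe_nnreal]
    _ ≤ eVariationOn F univ + ε := by
        gcongr
        exact eVariationOn.sum_le_of_monotoneOn_Iic hw_mono fun _ _ => mem_univ _

/-- A function of bounded variation is bounded. -/
lemma BoundedVariationOn.exists_abs_le {f : ℝ → ℝ} (hf : BoundedVariationOn f univ) :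
    ∃ C, ∀ x, |f x| ≤ C := by
  refine ⟨|f 0| + (eVariationOn f univ).toReal, fun x => ?_⟩
  have h := hf.dist_le (mem_univ x) (mem_univ 0)
  rw [Real.dist_eq] at h
  linarith [abs_sub_abs_le_abs_sub (f x) (f 0)]

/-- The absolute value of a function of bounded variation is integrable on bounded intervals. -/
lemma BoundedVariationOn.intervalIntegrable_abs {f : ℝ → ℝ} (hf : BoundedVariationOn f univ)
    (a b : ℝ) : IntervalIntegrable (fun s => |f s|) volume a b := by
  obtain ⟨p, q, hp, hq, rfl⟩ :=
    hf.locallyBoundedVariationOn.exists_monotoneOn_sub_monotoneOn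
  exact ((hp.mono (subset_univ _)).intervalIntegrable.sub
    (hq.mono (subset_univ _)).intervalIntegrable).abs

lemma two_mul_mul_avgAbs (f : ℝ → ℝ) (y : ℝ) {t : ℝ} (ht : 0 < t) :
    2 * t * avgAbs f y t = ∫ s in (y - t)..(y + t), |f s| := by
  rw [avgAbs]; field_simp

lemma avgAbs_le {f : ℝ → ℝ} (hf : BoundedVariationOn f univ) {C y t : ℝ} (ht : 0 < t)
    (hC : ∀ x, |f x| ≤ C) : avgAbs f y t ≤ C := by
  have h : ∫ s in (y - t)..(y + t), |f s| ≤ ∫ _ in (y - t)..(y + t), C :=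
    intervalIntegral.integral_mono_on (by linarith) (hf.intervalIntegrable_abs _ _)
      intervalIntegrable_const fun x _ => hC x
  rw [← two_mul_mul_avgAbs f y ht, intervalIntegral.integral_const, smul_eq_mul] at h
  have : 2 * t * avgAbs f y t ≤ 2 * t * C := by linarith
  exact le_of_mul_le_mul_left this (by positivity)

lemma avgAbs_le_ntMax {f : ℝ → ℝ} (hf : BoundedVariationOn f univ) {α x y t : ℝ} (ht : 0 < t)
    (hx : |x - y| ≤ α * t) : avgAbs f y t ≤ ntMax α f x := by
  obtain ⟨C, hC⟩ := hf.exists_abs_le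
  refine le_csSup ⟨C, ?_⟩ ⟨y, t, ht, hx, rfl⟩
  rintro _ ⟨y, t, ht, -, rfl⟩
  exact avgAbs_le hf ht hC

lemma ntMax_nonempty (f : ℝ → ℝ) {α : ℝ} (hα : 0 ≤ α) (x : ℝ) :
    {r : ℝ | ∃ y t : ℝ, 0 < t ∧ |x - y| ≤ α * t ∧ r = avgAbs f y t}.Nonempty :=
  ⟨_, x, 1, one_pos, by simpa using hα, rfl⟩

lemma exists_lt_avgAbs {f : ℝ → ℝ} {α x c : ℝ} (hα : 0 ≤ α) (hc : c < ntMax α f x) :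
    ∃ y t, 0 < t ∧ |x - y| ≤ α * t ∧ c < avgAbs f y t := by
  obtain ⟨_, ⟨y, t, ht, hx, rfl⟩, h⟩ := exists_lt_of_lt_csSup (ntMax_nonempty f hα x) hc
  exact ⟨y, t, ht, hx, h⟩

lemma ntMax_le {f : ℝ → ℝ} {α x c : ℝ} (hα : 0 ≤ α)
    (h : ∀ y t, 0 < t → |x - y| ≤ α * t → avgAbs f y t ≤ c) : ntMax α f x ≤ c := by
  refine csSup_le (ntMax_nonempty f hα x) ?_
  rintro _ ⟨y, t, ht, hx, rfl⟩
  exact h y t ht hx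

lemma ntMax_mono {f : ℝ → ℝ} (hf : BoundedVariationOn f univ) {α β : ℝ} (hα : 0 ≤ α)
    (hαβ : α ≤ β) (x : ℝ) : ntMax α f x ≤ ntMax β f x :=
  ntMax_le hα fun _ _ ht hx => avgAbs_le_ntMax hf ht (hx.trans (by gcongr))

/-- An average that exceeds `ntMax α f` at `a` and `b`, and is admissible at some point between
them, is admissible only at points between them. -/
lemma lt_core_of_lt_avgAbs {f : ℝ → ℝ} (hf : BoundedVariationOn f univ) {α x y t μ : ℝ}
    (ht : 0 < t) (hx : |x - y| ≤ α * t) (hμ : μ < avgAbs f y t) :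
    (∀ a < x, ntMax α f a ≤ μ → a < y - α * t) ∧
    (∀ b > x, ntMax α f b ≤ μ → y + α * t < b) := by
  have hx := abs_le.mp hx
  constructor <;> intro c hcx hc <;> by_contra! hcon <;>
  · have := avgAbs_le_ntMax (α := α) (x := c) (y := y) hf ht (abs_le.mpr ⟨by linarith, by linarith⟩)
    linarith

/-- Finitely many values below `c` stay below some `μ < c`. -/
lemma exists_between_options {G : ℝ → ℝ} {A B : Option ℝ} {c d : ℝ} (hd : d < c)
    (hA : ∀ a ∈ A, G a < c) (hB : ∀ b ∈ B, G b < c) :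
    ∃ μ < c, d ≤ μ ∧ (∀ a ∈ A, G a ≤ μ) ∧ ∀ b ∈ B, G b ≤ μ := by
  have aux : ∀ (O : Option ℝ) (d : ℝ), d < c → (∀ a ∈ O, G a < c) →
      ∃ μ < c, d ≤ μ ∧ ∀ a ∈ O, G a ≤ μ := by
    rintro (_ | a) d hd h
    · exact ⟨d, hd, le_rfl, by simp⟩
    · exact ⟨max d (G a), max_lt hd (h a rfl), le_max_left _ _, by simp⟩
  obtain ⟨μ, h1, h2, h3⟩ := aux A d hd hA
  obtain ⟨ν, k1, k2, k3⟩ := aux B μ h1 hB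
  exact ⟨ν, k1, h2.trans k2, fun a ha => (h3 a ha).trans k2, k3⟩

/-- The variation of the nontangential maximal function decreases with the aperture. -/
theorem eVariationOn_ntMax_antitone {f : ℝ → ℝ} (hf : BoundedVariationOn f univ) {α β : ℝ}
    (hα : 0 ≤ α) (hαβ : α ≤ β) :
    eVariationOn (ntMax β f) univ ≤ eVariationOn (ntMax α f) univ := by
  refine eVariationOn_le_of_peaks
    (fun a η δ hη hδ => ⟨a, by simpa using hδ, by linarith [ntMax_mono hf hα hαβ a]⟩) ?_
  intro A B x η hη hA hB
  obtain ⟨μ, hμ, hημ, hμA, hμB⟩ := exists_between_options (sub_lt_self (ntMax β f x) hη)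
    (fun a ha => (hA a ha).2) (fun b hb => (hB b hb).2)
  obtain ⟨y, t, ht, hx, hlt⟩ := exists_lt_avgAbs (hα.trans hαβ) hμ
  obtain ⟨h1, h2⟩ := lt_core_of_lt_avgAbs hf ht hx hlt
  have hβt : 0 ≤ β * t := mul_nonneg (hα.trans hαβ) ht.le
  refine ⟨y, fun a ha => ?_, fun b hb => ?_, ?_⟩
  · linarith [h1 a (hA a ha).1 (hμA a ha)]
  · linarith [h2 b (hB b hb).1 (hμB b hb)]
  · have := avgAbs_le_ntMax (α := α) (x := y) (y := y) hf ht (by simpa using mul_nonneg hα ht.le)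
    linarith

lemma integral_abs_le_of_ntMax_le {f : ℝ → ℝ} (hf : BoundedVariationOn f univ) {α μ x l r : ℝ}
    (hlr : l ≤ r) (hx : |x - (l + r) / 2| ≤ α * ((r - l) / 2)) (hμ : ntMax α f x ≤ μ) :
    ∫ s in l..r, |f s| ≤ μ * (r - l) := by
  rcases hlr.eq_or_lt with rfl | hlt
  · simp
  have ht : 0 < (r - l) / 2 := by linarith
  have h := two_mul_mul_avgAbs f ((l + r) / 2) ht
  rw [show (l + r) / 2 - (r - l) / 2 = l by ring, show (l + r) / 2 + (r - l) / 2 = r by ring,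
    show 2 * ((r - l) / 2) = r - l by ring] at h
  rw [← h, mul_comm]
  have := (avgAbs_le_ntMax hf ht hx).trans hμ
  have : 0 ≤ r - l := by linarith
  gcongr

lemma ntMax_third_valley {f : ℝ → ℝ} (hf : BoundedVariationOn f univ) {a η δ : ℝ} (hη : 0 < η)
    (hδ : 0 < δ) : ∃ z, |z - a| < δ ∧ |f z| ≤ ntMax (1 / 3) f a + η := by
  by_contra! hcon
  have ht : 0 < δ / 2 := by linarith
  have h : ∫ _ in (a - δ / 2)..(a + δ / 2), (ntMax (1 / 3) f a + η) ≤
      ∫ s in (a - δ / 2)..(a + δ / 2), |f s| :=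
    intervalIntegral.integral_mono_on (by linarith) intervalIntegrable_const
      (hf.intervalIntegrable_abs _ _) fun x hx =>
        (hcon x (abs_lt.mpr ⟨by linarith [hx.1], by linarith [hx.2]⟩)).le
  rw [← two_mul_mul_avgAbs f a ht, intervalIntegral.integral_const, smul_eq_mul] at h
  have h2 := avgAbs_le_ntMax (α := 1 / 3) (x := a) (y := a) hf ht (by simp; positivity)
  have h3 : δ * (ntMax (1 / 3) f a + η) ≤ δ * avgAbs f a (δ / 2) := by linarith
  linarith [le_of_mul_le_mul_left h3 hδ]

lemma ntMax_third_peak {f : ℝ → ℝ} (hf : BoundedVariationOn f univ) (A B : Option ℝ) {x η : ℝ}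
    (hη : 0 < η) (hA : ∀ a ∈ A, a < x ∧ ntMax (1 / 3) f a < ntMax (1 / 3) f x)
    (hB : ∀ b ∈ B, x < b ∧ ntMax (1 / 3) f b < ntMax (1 / 3) f x) :
    ∃ y, (∀ a ∈ A, a < y) ∧ (∀ b ∈ B, y < b) ∧ ntMax (1 / 3) f x - η ≤ |f y| := by
  by_contra! hcon
  obtain ⟨μ, hμ, hημ, hμA, hμB⟩ := exists_between_options
    (sub_lt_self (ntMax (1 / 3) f x) hη) (fun a ha => (hA a ha).2) (fun b hb => (hB b hb).2)
  obtain ⟨y, t, ht, hx, hlt⟩ := exists_lt_avgAbs (by norm_num) hμ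
  obtain ⟨h1, h2⟩ := lt_core_of_lt_avgAbs hf ht hx hlt
  have right : ∃ c, y ≤ c ∧ (∀ b ∈ B, c ≤ b) ∧ ∫ s in c..(y + t), |f s| ≤ μ * (y + t - c) := by
    by_cases hb : ∃ b ∈ B, b ≤ y + t
    · obtain ⟨b, hb, hbt⟩ := hb
      have hyb := h2 b (hB b hb).1 (hμB b hb)
      refine ⟨(3 * b - (y + t)) / 2, by linarith, fun b' hb' => ?_,
        integral_abs_le_of_ntMax_le (x := b) hf (by linarith)
          (abs_le.mpr ⟨by linarith, by linarith⟩) (hμB b hb)⟩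
      obtain rfl := Option.mem_unique hb hb'
      linarith
    · push Not at hb
      exact ⟨y + t, by linarith, fun b h => (hb b h).le, by simp⟩
  have left : ∃ d, d ≤ y ∧ (∀ a ∈ A, a ≤ d) ∧ ∫ s in (y - t)..d, |f s| ≤ μ * (d - (y - t)) := by
    by_cases ha : ∃ a ∈ A, y - t ≤ a
    · obtain ⟨a, ha, hat⟩ := ha
      have hya := h1 a (hA a ha).1 (hμA a ha)
      refine ⟨(3 * a - (y - t)) / 2, by linarith, fun a' ha' => ?_,
        integral_abs_le_of_ntMax_le (x := a) hf (by linarith)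
          (abs_le.mpr ⟨by linarith, by linarith⟩) (hμA a ha)⟩
      obtain rfl := Option.mem_unique ha ha'
      linarith
    · push Not at ha
      exact ⟨y - t, by linarith, fun a h => (ha a h).le, by simp⟩
  obtain ⟨c, hyc, hcB, hc⟩ := right
  obtain ⟨d, hdy, hdA, hd⟩ := left
  have mid : ∫ s in d..c, |f s| ≤ ∫ _ in d..c, μ :=
    intervalIntegral.integral_mono_on_of_le_Ioo (by linarith) (hf.intervalIntegrable_abs _ _)
      intervalIntegrable_const fun z hz =>
        ((hcon z (fun a ha => (hdA a ha).trans_lt hz.1)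
          (fun b hb => hz.2.trans_le (hcB b hb))).le.trans hημ)
  rw [intervalIntegral.integral_const, smul_eq_mul] at mid
  have htot := two_mul_mul_avgAbs f y ht
  rw [← intervalIntegral.integral_add_adjacent_intervals
      (hf.intervalIntegrable_abs (y - t) d) (hf.intervalIntegrable_abs d (y + t)),
    ← intervalIntegral.integral_add_adjacent_intervals
      (hf.intervalIntegrable_abs d c) (hf.intervalIntegrable_abs c (y + t))] at htot
  have : 2 * t * avgAbs f y t ≤ 2 * t * μ := by linarith
  linarith [le_of_mul_le_mul_left this (by positivity)]

lemma eVariationOn_abs_le (f : ℝ → ℝ) (s : Set ℝ) :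
    eVariationOn (fun x => |f x|) s ≤ eVariationOn f s := by
  refine iSup_le fun ⟨n, u, hu, us⟩ => le_trans ?_ (eVariationOn.sum_le (n := n) hu us)
  refine Finset.sum_le_sum fun i _ => ?_
  rw [edist_dist, edist_dist, Real.dist_eq, Real.dist_eq]
  exact ENNReal.ofReal_le_ofReal (abs_abs_sub_abs_le_abs_sub _ _)

/-- For apertures at least `1 / 3`, the maximal function does not increase the variation. -/
theorem eVariationOn_ntMax_le {f : ℝ → ℝ} (hf : BoundedVariationOn f univ) {γ : ℝ}
    (hγ : 1 / 3 ≤ γ) : eVariationOn (ntMax γ f) univ ≤ eVariationOn f univ :=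
  calc eVariationOn (ntMax γ f) univ
      ≤ eVariationOn (ntMax (1 / 3) f) univ := eVariationOn_ntMax_antitone hf (by norm_num) hγ
    _ ≤ eVariationOn (fun x => |f x|) univ :=
        eVariationOn_le_of_peaks (fun _ _ _ hη hδ => ntMax_third_valley hf hη hδ)
          fun A B _ _ hη hA hB => ntMax_third_peak hf A B hη hA hB
    _ ≤ eVariationOn f univ := eVariationOn_abs_le f univ

/-- A function with values in `[0, 1]` that increases and then decreases has variation at
most `2`. -/
lemma eVariationOn_le_two {f : ℝ → ℝ} (h0 : ∀ x, 0 ≤ f x) (h1 : ∀ x, f x ≤ 1) {c : ℝ}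
    (hmono : MonotoneOn f (Iic c)) (hanti : AntitoneOn f (Ici c)) :
    eVariationOn f univ ≤ 2 := by
  have hedist : ∀ x y, edist (f x) (f y) = ENNReal.ofReal |f x - f y| := fun x y => by
    rw [edist_dist, Real.dist_eq]
  have hl : eVariationOn f (Iic c) ≤ 1 := by
    refine iSup_le fun ⟨n, u, hu, us⟩ => ?_
    simp only [hedist]
    rw [← ENNReal.ofReal_sum_of_nonneg fun i _ => abs_nonneg _, ENNReal.ofReal_le_one,
      Finset.sum_congr rfl fun i _ => abs_of_nonneg
        (sub_nonneg.mpr (hmono (us i) (us (i + 1)) (hu i.le_succ))),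
      Finset.sum_range_sub (fun i => f (u i))]
    linarith [h0 (u 0), h1 (u n)]
  have hr : eVariationOn f (Ici c) ≤ 1 := by
    refine iSup_le fun ⟨n, u, hu, us⟩ => ?_
    simp only [hedist]
    rw [← ENNReal.ofReal_sum_of_nonneg fun i _ => abs_nonneg _, ENNReal.ofReal_le_one,
      Finset.sum_congr rfl fun i _ => (abs_sub_comm _ _).trans (abs_of_nonneg
        (sub_nonneg.mpr (hanti (us i) (us (i + 1)) (hu i.le_succ)))),
      Finset.sum_range_sub' (fun i => f (u i))]
    linarith [h1 (u 0), h0 (u n)]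
  calc eVariationOn f univ = eVariationOn f (Iic c) + eVariationOn f (Ici c) := by
        rw [← eVariationOn.union f isGreatest_Iic isLeast_Ici, Iic_union_Ici]
    _ ≤ 1 + 1 := add_le_add hl hr
    _ = 2 := one_add_one_eq_two

/-- The indicator function of `[-1, 1]`. -/
noncomputable def bump : ℝ → ℝ := (Icc (-1) 1).indicator 1

lemma bump_apply (x : ℝ) : bump x = if -1 ≤ x ∧ x ≤ 1 then 1 else 0 := by
  simp [bump, indicator_apply, mem_Icc]

lemma bump_nonneg (x : ℝ) : 0 ≤ bump x := by
  rw [bump_apply]; split_ifs <;> norm_num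

lemma bump_le_one (x : ℝ) : bump x ≤ 1 := by
  rw [bump_apply]; split_ifs <;> norm_num

lemma eVariationOn_bump_le : eVariationOn bump univ ≤ 2 := by
  refine eVariationOn_le_two bump_nonneg bump_le_one (c := 0) ?_ ?_ <;>
  · intro x hx y hy hxy
    simp only [mem_Iic, mem_Ici] at hx hy
    simp only [bump_apply]
    split_ifs <;> grind

lemma boundedVariationOn_bump : BoundedVariationOn bump univ :=
  ne_top_of_le_ne_top ENNReal.ofNat_ne_top eVariationOn_bump_le

lemma eVariationOn_bump_ne_zero : eVariationOn bump univ ≠ 0 := by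
  intro h
  have := (eVariationOn.eq_zero_iff bump).mp h 0 (mem_univ _) 2 (mem_univ _)
  norm_num [bump_apply] at this

lemma integral_abs_bump_le {l r : ℝ} (hlr : l ≤ r) : ∫ s in l..r, |bump s| ≤ 2 := by
  have : ∀ s, |bump s| = (Icc (-1 : ℝ) 1).indicator 1 s := fun s => abs_of_nonneg (bump_nonneg s)
  simp only [this]
  rw [intervalIntegral.integral_of_le hlr, integral_indicator_one measurableSet_Icc,
    measureReal_restrict_apply measurableSet_Icc]
  refine (measureReal_mono inter_subset_left (by simp)).trans ?_
  norm_num [Real.volume_real_Icc]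

lemma one_le_ntMax_bump {γ : ℝ} (hγ : 0 ≤ γ) : 1 ≤ ntMax γ bump 0 := by
  refine le_trans (le_of_eq ?_)
    (avgAbs_le_ntMax (y := 0) boundedVariationOn_bump one_pos (by simpa using hγ))
  have h : ∫ s in (0 - 1 : ℝ)..(0 + 1), |bump s| = ∫ _ in (0 - 1 : ℝ)..(0 + 1), (1 : ℝ) := by
    refine intervalIntegral.integral_congr fun x hx => ?_
    rw [uIcc_of_le (by norm_num)] at hx
    have h1 : -1 ≤ x := by linarith [hx.1]
    have h2 : x ≤ 1 := by linarith [hx.2]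
    simp [bump_apply, h1, h2]
  rw [avgAbs, h]
  norm_num

lemma ntMax_bump_le {γ x : ℝ} (hγ : 0 ≤ γ) (hx : 1 < |x|) :
    ntMax γ bump x ≤ (1 + γ) / (|x| - 1) := by
  refine ntMax_le hγ fun y t ht hxy => ?_
  have hpos : 0 < |x| - 1 := by linarith
  by_cases hfar : 1 + t < |y|
  · have h0 : ∫ s in (y - t)..(y + t), |bump s| = ∫ _ in (y - t)..(y + t), (0 : ℝ) := by
      refine intervalIntegral.integral_congr fun s hs => ?_
      rw [uIcc_of_le (by linarith)] at hs
      have : ¬ (-1 ≤ s ∧ s ≤ 1) := by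
        rintro ⟨h1, h2⟩
        rcases abs_cases y with ⟨h, _⟩ | ⟨h, _⟩ <;> linarith [hs.1, hs.2]
      simp [bump_apply, this]
    rw [avgAbs, h0]
    simp only [intervalIntegral.integral_zero, mul_zero]
    positivity
  · have hle : |x| - 1 ≤ (1 + γ) * t := by
      linarith [abs_sub_abs_le_abs_sub x y]
    have hint := integral_abs_bump_le (l := y - t) (r := y + t) (by linarith)
    rw [← two_mul_mul_avgAbs _ _ ht] at hint
    have hA : 0 ≤ avgAbs bump y t := by
      have : 0 ≤ ∫ s in (y - t)..(y + t), |bump s| :=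
        intervalIntegral.integral_nonneg (by linarith) fun _ _ => abs_nonneg _
      rw [avgAbs]; positivity
    rw [le_div_iff₀ hpos]
    calc avgAbs bump y t * (|x| - 1) ≤ avgAbs bump y t * ((1 + γ) * t) := by gcongr
      _ = (1 + γ) * (t * avgAbs bump y t) := by ring
      _ ≤ (1 + γ) * 1 := by gcongr; linarith
      _ = 1 + γ := mul_one _

lemma two_le_eVariationOn_ntMax_bump {γ : ℝ} (hγ : 0 ≤ γ) :
    2 ≤ eVariationOn (ntMax γ bump) univ := by
  have hbound : ∀ R : ℝ, 1 < R →
      ENNReal.ofReal (2 * (1 - (1 + γ) / (R - 1))) ≤ eVariationOn (ntMax γ bump) univ := by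
    intro R hR
    set G := ntMax γ bump
    have hside : ∀ x, |x| = R → ENNReal.ofReal (1 - (1 + γ) / (R - 1)) ≤ edist (G 0) (G x) := by
      intro x hx
      rw [edist_dist, Real.dist_eq]
      refine ENNReal.ofReal_le_ofReal (le_trans ?_ (le_abs_self _))
      have h1 := ntMax_bump_le hγ (hx ▸ hR)
      rw [hx] at h1
      have h2 := one_le_ntMax_bump hγ
      linarith
    have hR' : |R| = R := abs_of_pos (by linarith)
    calc ENNReal.ofReal (2 * (1 - (1 + γ) / (R - 1)))
        = ENNReal.ofReal (1 - (1 + γ) / (R - 1)) + ENNReal.ofReal (1 - (1 + γ) / (R - 1)) := by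
          rw [ENNReal.ofReal_mul zero_le_two, ENNReal.ofReal_ofNat, two_mul]
      _ ≤ eVariationOn G (Iic 0) + eVariationOn G (Ici 0) := by
          refine add_le_add ((hside (-R) (by rw [abs_neg, hR'])).trans ?_)
            ((hside R hR').trans ?_)
          · exact eVariationOn.edist_le G self_mem_Iic (show -R ≤ 0 by linarith)
          · exact eVariationOn.edist_le G self_mem_Ici (show 0 ≤ R by linarith)
      _ = eVariationOn G univ := by
          rw [← eVariationOn.union G isGreatest_Iic isLeast_Ici, Iic_union_Ici]
  have hlim : Tendsto (fun R : ℝ => ENNReal.ofReal (2 * (1 - (1 + γ) / (R - 1)))) atTop (𝓝 2) := by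
    have h1 : Tendsto (fun R : ℝ => (1 + γ) / (R - 1)) atTop (𝓝 0) :=
      (tendsto_atTop_add_const_right _ (-1) tendsto_id).const_div_atTop _
    have h2 := ENNReal.tendsto_ofReal ((h1.const_sub 1).const_mul 2)
    simpa using h2
  exact le_of_tendsto hlim ((eventually_gt_atTop 1).mono hbound)

/-- If `0 ≤ α ≤ β` then `V(M^β f) ≤ V(M^α f)` for every `f` of bounded variation;
consequently `B(γ) = 1` for every `γ ≥ 1/3`. -/
theorem variation_ntMax_antitone_and_Bconst_eq_one :
    (∀ α β : ℝ, 0 ≤ α → α ≤ β → ∀ f : ℝ → ℝ, BoundedVariationOn f Set.univ →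
      eVariationOn (ntMax β f) Set.univ ≤ eVariationOn (ntMax α f) Set.univ) ∧
    (∀ γ : ℝ, (1 / 3 : ℝ) ≤ γ → Bconst γ = 1) := by
  refine ⟨fun α β hα hαβ f hf => eVariationOn_ntMax_antitone hf hα hαβ, fun γ hγ => ?_⟩
  refine le_antisymm (iSup₂_le fun f hf => ?_) ?_
  · exact ENNReal.div_le_of_le_mul (by simpa using eVariationOn_ntMax_le hf.1 hγ)
  · refine le_trans ?_ (le_iSup₂ (f := fun (f : ℝ → ℝ)
      (_ : BoundedVariationOn f univ ∧ eVariationOn f univ ≠ 0) =>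
        eVariationOn (ntMax γ f) univ / eVariationOn f univ) bump
      ⟨boundedVariationOn_bump, eVariationOn_bump_ne_zero⟩)
    rw [ENNReal.le_div_iff_mul_le (Or.inl eVariationOn_bump_ne_zero)
      (Or.inl boundedVariationOn_bump), one_mul]
    exact eVariationOn_bump_le.trans (two_le_eVariationOn_ntMax_bump (by linarith))
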